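/- arXiv:2108.08481 — 3 statements merged into one kernel-verified Lean document; each statement's English description precedes it below -/
import Mathlib

section
/- Let D ⊆ ℝ^d be a domain and let L be a continuous linear functional on C(cl D; ℝ). Then for every compact set K ⊆ C(cl D; ℝ) and every ε > 0 there exists κ ∈ C_c^∞(D) such that sup_{u∈K} |L(u) − ∫_D κ(x) u(x) dx| < ε. -/
open MeasureTheory

/-- A domain: a bounded, connected, open, topologically regular subset of `ℝ^k`. -/
def IsRegularDomain {k : ℕ} (D : Set (Fin k → ℝ)) : Prop :=
  IsOpen D ∧ IsConnected D ∧ Bornology.IsBounded D ∧ interior (closure D) = D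

open Classical in
/-- Extension by zero of a bounded continuous function on a subset. -/
noncomputable def extendZero {α : Type*} [TopologicalSpace α] {s : Set α}
    (u : BoundedContinuousFunction s ℝ) : α → ℝ :=
  fun x => if h : x ∈ s then u ⟨x, h⟩ else 0

theorem extendZero_of_mem {α : Type*} [TopologicalSpace α] {s : Set α}
    (u : BoundedContinuousFunction s ℝ) {x : α} (hx : x ∈ s) : extendZero u x = u ⟨x, hx⟩ :=
  dif_pos hx

theorem continuousOn_extendZero {α : Type*} [TopologicalSpace α] {s : Set α}
    (u : BoundedContinuousFunction s ℝ) : ContinuousOn (extendZero u) s := by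
  rw [continuousOn_iff_continuous_domRestrict]
  convert u.continuous using 1
  ext x
  exact extendZero_of_mem u x.2

theorem integrableOn_mul_extendZero {d : ℕ} {D : Set (Fin d → ℝ)} (hD : IsOpen D)
    (u : BoundedContinuousFunction (closure D) ℝ) {κ : (Fin d → ℝ) → ℝ} (hκ : Integrable κ) :
    IntegrableOn (fun x => κ x * extendZero u x) D := by
  refine Integrable.mul_bdd (c := ‖u‖) hκ.integrableOn
    (((continuousOn_extendZero u).mono subset_closure).aestronglyMeasurable hD.measurableSet) ?_
  refine (ae_restrict_iff' hD.measurableSet).2 (.of_forall fun x hx => ?_)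
  rw [extendZero_of_mem u (subset_closure hx)]
  exact u.norm_coe_le_norm _

/-- Averaging against a normalized bump function supported in `D` stays within `η` of `c` if the
averaged function is within `η` of `c` on the support of the bump. -/
theorem abs_sub_setIntegral_normed_mul_extendZero_le {d : ℕ} {D : Set (Fin d → ℝ)}
    (hD : IsOpen D) (u : BoundedContinuousFunction (closure D) ℝ) {p : Fin d → ℝ}
    (φ : ContDiffBump p) (hφ : Metric.closedBall p φ.rOut ⊆ D) {c η : ℝ}
    (h : ∀ y : closure D, dist y.1 p < φ.rOut → |c - u y| ≤ η) :
    |c - ∫ x in D, φ.normed volume x * extendZero u x| ≤ η := by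
  have hint : Integrable (φ.normed volume) := φ.integrable_normed
  have h1 : ∫ x in D, φ.normed volume x = 1 := by
    rw [setIntegral_eq_integral_of_forall_compl_eq_zero, φ.integral_normed]
    intro x hx
    by_contra hne
    have : x ∈ Function.support (φ.normed volume) := hne
    rw [φ.support_normed_eq] at this
    exact hx (hφ (Metric.ball_subset_closedBall this))
  have hc : c - ∫ x in D, φ.normed volume x * extendZero u x
      = ∫ x in D, φ.normed volume x * (c - extendZero u x) := by
    simp_rw [mul_sub]
    rw [integral_sub (hint.integrableOn.mul_const c) (integrableOn_mul_extendZero hD u hint),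
      integral_mul_const, h1, one_mul]
  have hη : ∫ x in D, φ.normed volume x * η = η := by rw [integral_mul_const, h1, one_mul]
  rw [hc, ← Real.norm_eq_abs]
  refine (norm_integral_le_of_norm_le (hint.integrableOn.mul_const η) ?_).trans_eq hη
  refine (ae_restrict_iff' hD.measurableSet).2 (.of_forall fun x hx => ?_)
  rw [norm_mul, Real.norm_of_nonneg (φ.nonneg_normed x), Real.norm_eq_abs]
  by_cases hx0 : φ.normed volume x = 0
  · simp [hx0]
  have hxs : x ∈ Function.support (φ.normed volume) := hx0
  rw [φ.support_normed_eq] at hxs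
  rw [extendZero_of_mem u (subset_closure hx)]
  exact mul_le_mul_of_nonneg_left (h ⟨x, subset_closure hx⟩ hxs) (φ.nonneg_normed x)

/-- A compact set of bounded continuous functions on a compact space is uniformly
equicontinuous. -/
theorem exists_forall_abs_sub_lt_of_isCompact {X : Type*} [PseudoMetricSpace X] [CompactSpace X]
    {K : Set (BoundedContinuousFunction X ℝ)} (hK : IsCompact K) {η : ℝ} (hη : 0 < η) :
    ∃ δ > 0, ∀ u ∈ K, ∀ x y : X, dist x y < δ → |u x - u y| < η := by
  have := isCompact_iff_compactSpace.1 hK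
  have hc : Continuous fun q : K × X => (q.1 : BoundedContinuousFunction X ℝ) q.2 := by fun_prop
  obtain ⟨δ, hδ, h⟩ :=
    Metric.uniformContinuous_iff.1 (CompactSpace.uniformContinuous_of_continuous hc) η hη
  refine ⟨δ, hδ, fun u hu x y hxy => ?_⟩
  exact h (a := (⟨u, hu⟩, x)) (b := (⟨u, hu⟩, y)) (by simpa [Prod.dist_eq] using hxy)

/-- A continuous linear functional on `C(cl D; ℝ)` (for a domain `D ⊆ ℝ^d`) can be
approximated, uniformly over a compact set `K`, by integration against a smooth
compactly supported kernel. -/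
theorem functional_approx_by_smooth_kernel_C
    (d : ℕ) (D : Set (Fin d → ℝ)) (hD : IsRegularDomain D)
    (L : BoundedContinuousFunction (closure D) ℝ →L[ℝ] ℝ)
    (K : Set (BoundedContinuousFunction (closure D) ℝ)) (hK : IsCompact K)
    (ε : ℝ) (hε : 0 < ε) :
    ∃ κ : (Fin d → ℝ) → ℝ, ContDiff ℝ (⊤ : ℕ∞) κ ∧ HasCompactSupport κ ∧ tsupport κ ⊆ D ∧
      ∀ u ∈ K, |L u - ∫ x in D, κ x * extendZero u x| < ε := by
  obtain ⟨hDo, -, hDb, -⟩ := hD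
  have hcl : IsCompact (closure D) := hDb.isCompact_closure
  have : CompactSpace (closure D) := isCompact_iff_compactSpace.1 hcl
  have hL : 0 < ‖L‖ + 1 := by positivity
  obtain ⟨δ, hδ, hosc⟩ := exists_forall_abs_sub_lt_of_isCompact hK (div_pos hε hL)
  obtain ⟨t, ht⟩ := hcl.elim_finite_subcover (fun p : D => Metric.ball (p : Fin d → ℝ) (δ / 2))
    (fun _ => Metric.isOpen_ball) fun x hx => by
      obtain ⟨p, hp, hxp⟩ := Metric.mem_closure_iff.1 hx (δ / 2) (by positivity)
      exact Set.mem_iUnion.2 ⟨⟨p, hp⟩, hxp⟩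
  obtain ⟨ρ, hρ⟩ := PartitionOfUnity.exists_isSubordinate (X := closure D) isClosed_univ
    (fun i : t => Subtype.val ⁻¹' Metric.ball (i.1 : Fin d → ℝ) (δ / 2))
    (fun _ => Metric.isOpen_ball.preimage continuous_subtype_val) fun x _ => by
      obtain ⟨i, hi, hx⟩ := Set.mem_iUnion₂.1 (ht x.2)
      exact Set.mem_iUnion.2 ⟨⟨i, hi⟩, hx⟩
  have hρ1 (x : closure D) : ∑ i, ρ i x = 1 := by
    rw [← finsum_eq_sum_of_fintype, ρ.sum_eq_one (Set.mem_univ x)]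
  have hbump (i : t) : ∃ φ : ContDiffBump (i.1 : Fin d → ℝ),
      φ.rOut ≤ δ / 2 ∧ Metric.closedBall (i.1 : Fin d → ℝ) φ.rOut ⊆ D := by
    obtain ⟨r, hr, hrD⟩ := Metric.nhds_basis_closedBall.mem_iff.1 (hDo.mem_nhds i.1.2)
    have hm : 0 < min r (δ / 2) := lt_min hr (by positivity)
    exact ⟨⟨min r (δ / 2) / 2, min r (δ / 2), by positivity, half_lt_self hm⟩, min_le_right _ _,
      (Metric.closedBall_subset_closedBall (min_le_left _ _)).trans hrD⟩
  choose φ hφδ hφD using hbump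
  let R (i : t) : BoundedContinuousFunction (closure D) ℝ :=
    BoundedContinuousFunction.mkOfCompact (ρ i)
  let κ : (Fin d → ℝ) → ℝ := fun x => ∑ i, L (R i) * (φ i).normed volume x
  have hsupp : tsupport κ ⊆ ⋃ i, Metric.closedBall (i.1 : Fin d → ℝ) (φ i).rOut := by
    refine closure_minimal (fun x hx => ?_)
      (isClosed_iUnion_of_finite fun _ => Metric.isClosed_closedBall)
    obtain ⟨i, -, hi⟩ := Finset.exists_ne_zero_of_sum_ne_zero hx
    have hxs : x ∈ Function.support ((φ i).normed volume) := right_ne_zero_of_mul hi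
    rw [(φ i).support_normed_eq] at hxs
    exact Set.mem_iUnion.2 ⟨i, Metric.ball_subset_closedBall hxs⟩
  refine ⟨κ, ContDiff.sum fun i _ => contDiff_const.mul (φ i).contDiff_normed,
    (isCompact_iUnion fun i => isCompact_closedBall _ _).of_isClosed_subset
      (isClosed_tsupport κ) hsupp,
    hsupp.trans (Set.iUnion_subset hφD), fun u hu => ?_⟩
  let a (i : t) : ℝ := ∫ x in D, (φ i).normed volume x * extendZero u x
  have hκ : ∫ x in D, κ x * extendZero u x = ∑ i, a i * L (R i) := by
    simp_rw [κ, Finset.sum_mul, mul_assoc]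
    rw [integral_finsetSum _ fun i _ =>
      (integrableOn_mul_extendZero hDo u (φ i).integrable_normed).const_mul _]
    simp_rw [integral_const_mul, a, mul_comm]
  have hdiff : L u - ∫ x in D, κ x * extendZero u x = L (u - ∑ i, a i • R i) := by
    simp [hκ]
  have hnorm : ‖u - ∑ i, a i • R i‖ ≤ ε / (‖L‖ + 1) := by
    refine (BoundedContinuousFunction.norm_le (by positivity)).2 fun x => ?_
    have hx : (u - ∑ i, a i • R i) x = ∑ i, ρ i x * (u x - a i) := by
      simp_rw [mul_sub, Finset.sum_sub_distrib, ← Finset.sum_mul, hρ1]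
      simp [R, mul_comm]
    have hη : ∑ i, ρ i x * (ε / (‖L‖ + 1)) = ε / (‖L‖ + 1) := by
      rw [← Finset.sum_mul, hρ1, one_mul]
    rw [hx, ← hη]
    refine norm_sum_le_of_le _ fun i _ => ?_
    rw [norm_mul, Real.norm_of_nonneg (ρ.nonneg i x), Real.norm_eq_abs]
    by_cases h0 : ρ i x = 0
    · simp [h0]
    refine mul_le_mul_of_nonneg_left ?_ (ρ.nonneg i x)
    have hxi : dist x.1 (i.1 : Fin d → ℝ) < δ / 2 := hρ i (subset_tsupport _ h0)
    refine abs_sub_setIntegral_normed_mul_extendZero_le hDo u (φ i) (hφD i) fun y hy =>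
      (hosc u hu x y ?_).le
    calc dist x.1 y.1 ≤ dist x.1 i.1.1 + dist y.1 i.1.1 := dist_triangle_right _ _ _
      _ < δ := by linarith [hφδ i]
  rw [hdiff, ← Real.norm_eq_abs]
  calc ‖L (u - ∑ i, a i • R i)‖ ≤ ‖L‖ * (ε / (‖L‖ + 1)) := L.le_opNorm_of_le hnorm
    _ < (‖L‖ + 1) * (ε / (‖L‖ + 1)) := by gcongr; linarith
    _ = ε := mul_div_cancel₀ _ hL.ne'
end

section
/- Let D ⊆ ℝ^d be a domain and let L be a continuous linear functional on C(cl D; ℝ). Then for every compact set K ⊆ C(cl D; ℝ) and every ε > 0 there exist n ∈ ℕ, pairwise distinct points y_1, …, y_n lying in D (the open set, not its boundary), and real numbers c_1, …, c_n such that sup_{u∈K} |L(u) − Σ_{j=1}^n c_j u(y_j)| ≤ ε. -/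
open scoped BigOperators

open scoped BoundedContinuousFunction in
/-- On a compact metric space, any continuous functional on the bounded continuous functions is
approximated, uniformly over a compact set, by combinations of evaluations at points of a given
dense set. -/
theorem Dense.exists_finset_functional_approx {X : Type*} [MetricSpace X] [CompactSpace X]
    {S : Set X} (hS : Dense S) (L : (X →ᵇ ℝ) →L[ℝ] ℝ) {K : Set (X →ᵇ ℝ)} (hK : IsCompact K)
    {ε : ℝ} (hε : 0 < ε) :
    ∃ (T : Finset X) (c : X → ℝ), (∀ t ∈ T, t ∈ S) ∧
      ∀ u ∈ K, |L u - ∑ t ∈ T, c t * u t| ≤ ε := by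
  have hL : 0 < ‖L‖ + 1 := by positivity
  set η := ε / (‖L‖ + 1)
  have η_pos : 0 < η := by positivity
  -- `K` is uniformly equicontinuous
  obtain ⟨δ, δ_pos, hδ⟩ : ∃ δ > 0, ∀ u ∈ K, ∀ x y : X, dist x y < δ → |u x - u y| ≤ η := by
    have : CompactSpace K := isCompact_iff_compactSpace.mp hK
    have hc : Continuous fun p : K × X => (p.1 : X →ᵇ ℝ) p.2 :=
      continuous_eval.comp (continuous_subtype_val.prodMap continuous_id)
    obtain ⟨δ, δ_pos, hδ⟩ := Metric.uniformContinuous_iff.mp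
      (CompactSpace.uniformContinuous_of_continuous hc) η η_pos
    refine ⟨δ, δ_pos, fun u hu x y hxy => ?_⟩
    have := hδ (a := (⟨u, hu⟩, x)) (b := (⟨u, hu⟩, y)) (by simpa [Prod.dist_eq, δ_pos] using hxy)
    exact this.le
  obtain ⟨T, hTS, hT⟩ : ∃ T : Finset X, (∀ t ∈ T, t ∈ S) ∧ ∀ x, ∃ t ∈ T, dist x t < δ := by
    obtain ⟨b, hbS, hb, hcov⟩ := (isCompact_univ (X := X)).elim_finite_subcover_image
      (b := S) (c := fun t => Metric.ball t δ) (fun _ _ => Metric.isOpen_ball) (fun x _ => by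
        obtain ⟨t, ht, hxt⟩ := hS.exists_dist_lt x δ_pos
        exact Set.mem_biUnion ht hxt)
    refine ⟨hb.toFinset, fun t ht => hbS (hb.mem_toFinset.mp ht), fun x => ?_⟩
    obtain ⟨t, ht, hxt⟩ := Set.mem_iUnion₂.mp (hcov (Set.mem_univ x))
    exact ⟨t, hb.mem_toFinset.mpr ht, hxt⟩
  -- a partition of unity subordinate to the balls of radius `δ` about `T`
  let g : X → X → ℝ := fun t x => max (δ - dist x t) 0
  have g_nonneg : ∀ t x, 0 ≤ g t x := fun t x => le_max_right _ _
  have g_cont : ∀ t, Continuous (g t) := fun t => by fun_prop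
  have sum_pos : ∀ x, 0 < ∑ s ∈ T, g s x := fun x => by
    obtain ⟨t, ht, hxt⟩ := hT x
    exact Finset.sum_pos' (fun s _ => g_nonneg s x) ⟨t, ht, lt_max_of_lt_left (sub_pos.mpr hxt)⟩
  let φ : X → (X →ᵇ ℝ) := fun t => BoundedContinuousFunction.mkOfCompact
    ⟨fun x => g t x / ∑ s ∈ T, g s x, (g_cont t).div
      (continuous_finsetSum _ fun s _ => g_cont s) fun x => (sum_pos x).ne'⟩
  have φ_apply : ∀ t x, φ t x = g t x / ∑ s ∈ T, g s x := fun _ _ => rfl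
  have φ_nonneg : ∀ t x, 0 ≤ φ t x := fun t x => div_nonneg (g_nonneg t x) (sum_pos x).le
  have φ_sum : ∀ x, ∑ t ∈ T, φ t x = 1 := fun x => by
    simp_rw [φ_apply, ← Finset.sum_div]
    exact div_self (sum_pos x).ne'
  refine ⟨T, fun t => L (φ t), hTS, fun u hu => ?_⟩
  have hQ : ‖u - ∑ t ∈ T, u t • φ t‖ ≤ η := by
    refine (BoundedContinuousFunction.norm_le η_pos.le).mpr fun x => ?_
    have hx : (u - ∑ t ∈ T, u t • φ t) x = ∑ t ∈ T, φ t x * (u x - u t) := by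
      simp only [BoundedContinuousFunction.coe_sub, Pi.sub_apply,
        BoundedContinuousFunction.sum_apply, BoundedContinuousFunction.coe_smul, smul_eq_mul,
        mul_sub, Finset.sum_sub_distrib, ← Finset.sum_mul, φ_sum, one_mul]
      simp only [mul_comm]
    rw [hx]
    calc ‖∑ t ∈ T, φ t x * (u x - u t)‖ ≤ ∑ t ∈ T, ‖φ t x * (u x - u t)‖ := norm_sum_le _ _
      _ ≤ ∑ t ∈ T, φ t x * η := Finset.sum_le_sum fun t _ => by
          rw [norm_mul, Real.norm_eq_abs, Real.norm_eq_abs, abs_of_nonneg (φ_nonneg t x)]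
          by_cases hxt : dist x t < δ
          · exact mul_le_mul_of_nonneg_left (hδ u hu x t hxt) (φ_nonneg t x)
          · have : g t x = 0 := max_eq_right (by linarith)
            simp [φ_apply, this]
      _ = η := by rw [← Finset.sum_mul, φ_sum, one_mul]
  have hLQ : L u - ∑ t ∈ T, L (φ t) * u t = L (u - ∑ t ∈ T, u t • φ t) := by
    simp [map_sub, map_sum, mul_comm]
  rw [hLQ, ← Real.norm_eq_abs]
  calc ‖L (u - ∑ t ∈ T, u t • φ t)‖ ≤ ‖L‖ * η := L.le_opNorm_of_le hQ
    _ ≤ (‖L‖ + 1) * η := by gcongr; linarith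
    _ = ε := mul_div_cancel₀ _ hL.ne'

/-- A continuous linear functional on `C(cl D; ℝ)` (for a domain `D ⊆ ℝ^d`) can be
approximated, uniformly over a compact set `K`, by a finite linear combination of
point evaluations at pairwise distinct points of the open set `D`. -/
theorem functional_approx_by_point_evaluations
    (d : ℕ) (D : Set (Fin d → ℝ)) (hD : IsRegularDomain D)
    (L : BoundedContinuousFunction (closure D) ℝ →L[ℝ] ℝ)
    (K : Set (BoundedContinuousFunction (closure D) ℝ)) (hK : IsCompact K)
    (ε : ℝ) (hε : 0 < ε) :
    ∃ (n : ℕ) (y : Fin n → (Fin d → ℝ)) (hy : ∀ j, y j ∈ D) (c : Fin n → ℝ),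
      Function.Injective y ∧
      ∀ u ∈ K, |L u - ∑ j : Fin n, c j * u ⟨y j, subset_closure (hy j)⟩| ≤ ε := by
  have : CompactSpace (closure D) :=
    isCompact_iff_compactSpace.mp hD.2.2.1.isCompact_closure
  have hS : Dense {x : closure D | (x : Fin d → ℝ) ∈ D} := fun x => by
    rw [closure_subtype]
    convert x.2 using 2
    ext z
    exact ⟨by rintro ⟨w, hw, rfl⟩; exact hw, fun hz => ⟨⟨z, subset_closure hz⟩, hz, rfl⟩⟩
  obtain ⟨T, c, hT, hc⟩ := hS.exists_finset_functional_approx L hK hε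
  refine ⟨T.card, fun j => (T.equivFin.symm j : closure D),
    fun j => hT _ (T.equivFin.symm j).2, fun j => c (T.equivFin.symm j), ?_, fun u hu => ?_⟩
  · exact Subtype.val_injective.comp (Subtype.val_injective.comp T.equivFin.symm.injective)
  · convert hc u hu using 3
    rw [← Finset.sum_coe_sort T]
    exact T.equivFin.symm.sum_comp fun t : T => c t * u t
end

section
/- Let D ⊆ ℝ^d be a domain, let 1 ≤ p < ∞, let n ∈ ℕ, and let c_1, …, c_n be continuous linear functionals on L^p(D; ℝ). Define F : L^p(D; ℝ) → ℝ^n by F(a) = (c_1(a), …, c_n(a)). Then for every compact set K ⊆ L^p(D; ℝ), every σ ∈ A_0, and every ε > 0, there exist L ∈ ℕ and a σ-neural network κ ∈ N_L(σ; ℝ^d × ℝ^d, ℝ^{n×1}) such that sup_{a∈K} sup_{y∈cl D} |F(a) − ∫_D κ(y, x) a(x) dx|₁ ≤ ε, where |·|₁ denotes the ℓ¹ norm on ℝ^n. -/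
open MeasureTheory Filter
open scoped ENNReal BigOperators

noncomputable section

/-- `IsNNRep σ n m f` : `f` is of the form `x ↦ W_n σ(… W_1 σ(W_0 x + b_0) + b_1 …) + b_n`
with output dimension `m`. -/
def IsNNRep (σ : ℝ → ℝ) {ι : Type*} [Fintype ι] :
    ℕ → (m : ℕ) → ((ι → ℝ) → (Fin m → ℝ)) → Prop
  | 0, m, f => ∃ (W : Matrix (Fin m) ι ℝ) (b : Fin m → ℝ),
      f = fun x => W.mulVec x + b
  | n + 1, m, f => ∃ (k : ℕ) (g : (ι → ℝ) → (Fin k → ℝ))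
      (W : Matrix (Fin m) (Fin k) ℝ) (b : Fin m → ℝ),
      IsNNRep σ n k g ∧ f = fun x => W.mulVec (fun i => σ (g x i)) + b

/-- `f` is an `n`-layer real-valued `σ`-neural network. -/
def IsNN (σ : ℝ → ℝ) {ι : Type*} [Fintype ι] (n : ℕ) (f : (ι → ℝ) → ℝ) : Prop :=
  ∃ g : (ι → ℝ) → (Fin 1 → ℝ), IsNNRep σ n 1 g ∧ f = fun x => g x 0

/-- vector-valued neural networks, componentwise. -/
def IsNNV (σ : ℝ → ℝ) {ι : Type*} [Fintype ι] (n : ℕ) {m : ℕ}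
    (f : (ι → ℝ) → (Fin m → ℝ)) : Prop :=
  ∀ i : Fin m, IsNN σ n fun x => f x i

/-- matrix-valued neural networks, entrywise. -/
def IsNNM (σ : ℝ → ℝ) {ι : Type*} [Fintype ι] (n : ℕ) {a b : ℕ}
    (f : (ι → ℝ) → Matrix (Fin a) (Fin b) ℝ) : Prop :=
  ∀ (i : Fin a) (j : Fin b), IsNN σ n fun x => f x i j

/-- The class `A_0` of activation functions. -/
def MemA0 (σ : ℝ → ℝ) : Prop :=
  Continuous σ ∧ ∃ n : ℕ, ∀ (k : ℕ) (K : Set (Fin k → ℝ)), IsCompact K →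
    ∀ f : (Fin k → ℝ) → ℝ, ContinuousOn f K → ∀ ε : ℝ, 0 < ε →
      ∃ g : (Fin k → ℝ) → ℝ, IsNN σ n g ∧ ∀ x ∈ K, |f x - g x| ≤ ε

/-- The class `A^L_0` of linearly bounded activation functions. -/
def MemAL0 (σ : ℝ → ℝ) : Prop :=
  MemA0 σ ∧ Measurable σ ∧ ∃ C : ℝ, ∀ x : ℝ, |σ x| ≤ C * (1 + |x|)

/-- The class `BA` of activations admitting bounded approximations to the identity. -/
def MemBA (σ : ℝ → ℝ) : Prop :=
  MemA0 σ ∧ ∀ (k : ℕ) (K : Set (Fin k → ℝ)), IsCompact K →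
    ∀ ε : ℝ, 0 < ε → ∀ C : ℝ, 0 ≤ C →
      (∀ x ∈ K, ∀ y ∈ K, Real.sqrt (∑ i, (x i - y i) ^ 2) ≤ C) →
      ∃ (n : ℕ) (f : (Fin k → ℝ) → (Fin k → ℝ)), IsNNV σ n f ∧
        (∀ x ∈ K, Real.sqrt (∑ i, (f x i - x i) ^ 2) ≤ ε) ∧
        ∀ x, Real.sqrt (∑ i, (f x i) ^ 2) ≤ C

/-- affine kernel integral operators `IO(σ; D, ℝ^{d1}, ℝ^{d2})`. -/
def IsIO (σ : ℝ → ℝ) {d : ℕ} (D : Set (Fin d → ℝ)) (d1 d2 : ℕ)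
    (S : ((Fin d → ℝ) → (Fin d1 → ℝ)) → ((Fin d → ℝ) → (Fin d2 → ℝ))) : Prop :=
  ∃ (n1 n2 : ℕ) (κ : ((Fin d ⊕ Fin d) → ℝ) → Matrix (Fin d2) (Fin d1) ℝ)
    (b : (Fin d → ℝ) → (Fin d2 → ℝ)),
    IsNNM σ n1 κ ∧ IsNNV σ n2 b ∧
    S = fun f x => (∫ y in D, (κ (Sum.elim x y)).mulVec (f y)) + b x

/-- The chain `S_{n-1} σ1 (⋯ S_2 σ1 (S_1 (S_0 f)) ⋯)` of `n` integral operators. -/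
inductive NOChain (σ1 σ2 : ℝ → ℝ) {d : ℕ} (D : Set (Fin d → ℝ)) (da : ℕ) :
    ℕ → (m : ℕ) → (((Fin d → ℝ) → (Fin da → ℝ)) → ((Fin d → ℝ) → (Fin m → ℝ))) → Prop
  | base {d0 d1 : ℕ}
      {S0 : ((Fin d → ℝ) → (Fin da → ℝ)) → ((Fin d → ℝ) → (Fin d0 → ℝ))}
      {S1 : ((Fin d → ℝ) → (Fin d0 → ℝ)) → ((Fin d → ℝ) → (Fin d1 → ℝ))}
      (h0 : IsIO σ2 D da d0 S0) (h1 : IsIO σ2 D d0 d1 S1) :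
      NOChain σ1 σ2 D da 2 d1 fun f => S1 (S0 f)
  | step {n m m' : ℕ}
      {V : ((Fin d → ℝ) → (Fin da → ℝ)) → ((Fin d → ℝ) → (Fin m → ℝ))}
      {S : ((Fin d → ℝ) → (Fin m → ℝ)) → ((Fin d → ℝ) → (Fin m' → ℝ))}
      (hV : NOChain σ1 σ2 D da n m V) (hS : IsIO σ2 D m m' S) :
      NOChain σ1 σ2 D da (n + 1) m' fun f => S fun y i => σ1 (V f y i)

/-- `n`-layer neural operators `NO_n(σ1, σ2, σ3; D, D', ℝ^{da}, ℝ^{du})`. -/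
def IsNO (σ1 σ2 σ3 : ℝ → ℝ) {d d' : ℕ} (D : Set (Fin d → ℝ)) (D' : Set (Fin d' → ℝ))
    (da du n : ℕ)
    (G : ((Fin d → ℝ) → (Fin da → ℝ)) → ((Fin d' → ℝ) → (Fin du → ℝ))) : Prop :=
  ∃ (m : ℕ) (V : ((Fin d → ℝ) → (Fin da → ℝ)) → ((Fin d → ℝ) → (Fin m → ℝ)))
    (l : ℕ) (κ : ((Fin d' ⊕ Fin d) → ℝ) → Matrix (Fin du) (Fin m) ℝ),
    NOChain σ1 σ2 D da n m V ∧ IsNNM σ3 l κ ∧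
    G = fun f x => ∫ y in D, (κ (Sum.elim x y)).mulVec (V f y)

section Functionals

open Topology

theorem abs_sub_clamp_le {C a : ℝ} (ha : |a| ≤ C) (b : ℝ) :
    |a - max (-C) (min C b)| ≤ |a - b| := by
  obtain ⟨h₁, h₂⟩ := abs_le.1 ha
  have h := (abs_max_sub_max_le_abs a (min C b) (-C)).trans
    (by simpa [min_eq_right h₂] using abs_min_sub_min_le_max C a C b)
  rwa [max_comm, max_eq_right h₁, max_comm (min C b)] at h

variable {α : Type*} [MeasurableSpace α] {μ : Measure α} {p : ℝ≥0∞}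

theorem integral_mul_indicatorConstLp {s : Set α} (hs : MeasurableSet s) (hμs : μ s ≠ ∞) (c : ℝ)
    (v : α → ℝ) : ∫ x, v x * indicatorConstLp p hs hμs c x ∂μ = c * ∫ x in s, v x ∂μ := by
  rw [← integral_const_mul, ← integral_indicator hs]
  refine integral_congr_ae ?_
  filter_upwards [indicatorConstLp_coeFn (p := p) (hs := hs) (hμs := hμs) (c := c)] with x hx
  rw [hx]
  by_cases h : x ∈ s <;> simp [h, mul_comm]

variable [Fact (1 ≤ p)]

theorem equicontinuous_of_norm_le {E : Type*} [NormedAddCommGroup E] [NormedSpace ℝ E]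
    {T : ℕ → E →L[ℝ] ℝ} {B : ℝ} (hB : ∀ k x, ‖T k x‖ ≤ B * ‖x‖) :
    Equicontinuous fun k => (T k : E → ℝ) := by
  have h : (∃ C, ∀ k x, ‖T k x‖ ≤ C * ‖x‖) ↔ Equicontinuous ((↑) ∘ T : ℕ → E → ℝ) :=
    (NormedSpace.equicontinuous_TFAE T).out 3 1
  exact h.1 ⟨B, hB⟩

/-- A pointwise convergent, uniformly bounded sequence of continuous linear functionals
converges uniformly on compact sets. -/
theorem eventually_forall_mem_abs_sub_lt {E : Type*} [NormedAddCommGroup E] [NormedSpace ℝ E]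
    {T : ℕ → E →L[ℝ] ℝ} {φ : E →L[ℝ] ℝ} {B : ℝ} (hB : ∀ k x, ‖T k x‖ ≤ B * ‖x‖)
    (hT : ∀ x, Tendsto (fun k => T k x) atTop (𝓝 (φ x))) {K : Set E} (hK : IsCompact K)
    {ε : ℝ} (hε : 0 < ε) : ∀ᶠ k in atTop, ∀ x ∈ K, |φ x - T k x| < ε := by
  have heq : Equicontinuous fun k => (T k : E → ℝ) :=
    equicontinuous_of_norm_le hB
  have : CompactSpace K := isCompact_iff_compactSpace.1 hK
  have heqK : Equicontinuous fun k (x : K) => T k x := fun x U hU =>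
    continuousAt_subtype_val.eventually (heq x U hU)
  have h := (heqK.tendsto_uniformFun_iff_pi atTop fun x : K => φ x).2
    (tendsto_pi_nhds.2 fun x => hT x)
  rw [UniformFun.tendsto_iff_tendstoUniformly] at h
  filter_upwards [Metric.tendstoUniformly_iff.1 h ε hε] with k hk x hx
  exact hk ⟨x, hx⟩

/-- To check pointwise convergence of a bounded sequence of functionals on `L^p`, it suffices to
consider indicators. -/
theorem tendsto_of_tendsto_indicatorConstLp (hp : p ≠ ∞) {T : ℕ → Lp ℝ p μ →L[ℝ] ℝ}
    {φ : Lp ℝ p μ →L[ℝ] ℝ} {B : ℝ} (hB : ∀ k a, ‖T k a‖ ≤ B * ‖a‖)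
    (hT : ∀ (c : ℝ) (s : Set α) (hs : MeasurableSet s) (hμs : μ s ≠ ∞),
      Tendsto (fun k => T k (indicatorConstLp p hs hμs c)) atTop
        (𝓝 (φ (indicatorConstLp p hs hμs c)))) (a : Lp ℝ p μ) :
    Tendsto (fun k => T k a) atTop (𝓝 (φ a)) := by
  have heq : Equicontinuous fun k => (T k : Lp ℝ p μ → ℝ) :=
    equicontinuous_of_norm_le hB
  refine Lp.induction hp (fun a => Tendsto (fun k => T k a) atTop (𝓝 (φ a))) ?_ ?_
    (heq.isClosed_setOfPred_tendsto φ.continuous) a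
  · intro c s hs hμs
    exact hT c s hs hμs.ne
  · intro f g hf hg _ h₁ h₂
    simpa only [map_add] using h₁.add h₂

/-- Multiplication by a bounded function, as an operator on `L^p`. -/
theorem exists_clm_coeFn_ae_eq_mul {u : α → ℝ} (hu : AEStronglyMeasurable u μ) {C : ℝ}
    (hC : ∀ᵐ x ∂μ, |u x| ≤ C) :
    ∃ T : Lp ℝ p μ →L[ℝ] Lp ℝ p μ, (∀ a, T a =ᵐ[μ] fun x => u x * a x) ∧
      ∀ a, ‖T a‖ ≤ C * ‖a‖ := by
  have hmul : ∀ a : Lp ℝ p μ, ∀ᵐ x ∂μ, ‖u x * a x‖ ≤ C * ‖a x‖ := fun a => by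
    filter_upwards [hC] with x hx
    rw [norm_mul]
    gcongr
    exact hx
  have hmem : ∀ a : Lp ℝ p μ, MemLp (fun x => u x * a x) p μ := fun a =>
    (Lp.memLp a).of_le_mul (hu.mul (Lp.aestronglyMeasurable a)) (hmul a)
  have hnorm : ∀ a : Lp ℝ p μ, ‖(hmem a).toLp‖ ≤ C * ‖a‖ := fun a => by
    refine Lp.norm_le_mul_norm_of_ae_le_mul ?_
    filter_upwards [(hmem a).coeFn_toLp, hmul a] with x hx hx'
    rwa [hx]
  refine ⟨LinearMap.mkContinuous
    { toFun := fun a => (hmem a).toLp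
      map_add' := fun a b => ?_
      map_smul' := fun c a => ?_ } C hnorm, fun a => (hmem a).coeFn_toLp, hnorm⟩
  · rw [← MemLp.toLp_add]
    refine MemLp.toLp_congr _ _ ?_
    filter_upwards [Lp.coeFn_add a b] with x hx
    simp only [hx, Pi.add_apply, mul_add]
  · rw [RingHom.id_apply, ← MemLp.toLp_const_smul]
    refine MemLp.toLp_congr _ _ ?_
    filter_upwards [Lp.coeFn_smul c a] with x hx
    simp [hx, mul_left_comm]

theorem Lp.integrable_mul_of_ae_bdd [IsFiniteMeasure μ] {u : α → ℝ}
    (hu : AEStronglyMeasurable u μ) {C : ℝ} (hC : ∀ᵐ x ∂μ, |u x| ≤ C) (a : Lp ℝ p μ) :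
    Integrable (fun x => u x * a x) μ :=
  ((Lp.memLp a).integrable Fact.out).bdd_mul hu hC

theorem exists_clm_apply_eq_integral [IsFiniteMeasure μ] :
    ∃ I : Lp ℝ p μ →L[ℝ] ℝ, ∀ a, I a = ∫ x, a x ∂μ := by
  have hint : ∀ a : Lp ℝ p μ, Integrable a μ := fun a => (Lp.memLp a).integrable Fact.out
  refine ⟨LinearMap.mkContinuous
    { toFun := fun a => ∫ x, a x ∂μ
      map_add' := fun a b => ?_
      map_smul' := fun c a => ?_ } (μ Set.univ ^ (1 / (1 : ℝ≥0∞).toReal - 1 / p.toReal)).toReal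
      fun a => ?_, fun a => rfl⟩
  · rw [integral_congr_ae (Lp.coeFn_add a b)]
    exact integral_add (hint a) (hint b)
  · rw [integral_congr_ae (Lp.coeFn_smul c a)]
    exact integral_const_mul _ _
  · refine (norm_integral_le_integral_norm _).trans ?_
    rw [integral_norm_eq_lintegral_enorm (Lp.aestronglyMeasurable a), ← eLpNorm_one_eq_lintegral_enorm,
      Lp.norm_def, ← ENNReal.toReal_mul, mul_comm]
    refine ENNReal.toReal_mono ?_
      (eLpNorm_le_eLpNorm_mul_rpow_measure_univ Fact.out (Lp.aestronglyMeasurable a))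
    refine ENNReal.mul_ne_top (Lp.eLpNorm_ne_top a) (ENNReal.rpow_ne_top_of_nonneg ?_ (by simp))
    rw [ENNReal.toReal_one, sub_nonneg, div_one]
    rcases eq_or_ne p ∞ with rfl | hp
    · simp
    · have : 1 ≤ p.toReal := by
        simpa using ENNReal.toReal_mono hp (Fact.out : 1 ≤ p)
      exact (div_le_one (by linarith)).2 this

/-- Integration against bounded functions `u` is bounded on `L^p`, uniformly in terms of a bound
for `u`. -/
theorem exists_bound_clm_apply_eq_integral_mul (μ : Measure α) [IsFiniteMeasure μ] (p : ℝ≥0∞)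
    [Fact (1 ≤ p)] :
    ∃ B : ℝ, 0 ≤ B ∧ ∀ (u : α → ℝ) (C : ℝ), AEStronglyMeasurable u μ →
      (∀ᵐ x ∂μ, |u x| ≤ C) → ∃ T : Lp ℝ p μ →L[ℝ] ℝ,
        (∀ a, T a = ∫ x, u x * a x ∂μ) ∧ ∀ a, ‖T a‖ ≤ B * C * ‖a‖ := by
  obtain ⟨I, hI⟩ := exists_clm_apply_eq_integral (μ := μ) (p := p)
  refine ⟨‖I‖, norm_nonneg I, fun u C hu hC => ?_⟩
  obtain ⟨M, hM, hMC⟩ := exists_clm_coeFn_ae_eq_mul (p := p) hu hC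
  refine ⟨I ∘L M, fun a => ?_, fun a => ?_⟩
  · rw [ContinuousLinearMap.comp_apply, hI]
    exact integral_congr_ae (hM a)
  · rw [mul_assoc]
    exact (I.le_opNorm _).trans (by gcongr; exact hMC a)

/-- The functional on `L^p` given by a bounded function can be approximated, uniformly on compact
sets, by functionals given by bounded continuous functions. -/
theorem exists_continuous_integral_mul_approx [TopologicalSpace α] [NormalSpace α] [BorelSpace α]
    [IsFiniteMeasure μ] [μ.WeaklyRegular] (hp : p ≠ ∞) {u : α → ℝ}
    (hu : AEStronglyMeasurable u μ) {C : ℝ} (hC : ∀ x, |u x| ≤ C) {K : Set (Lp ℝ p μ)}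
    (hK : IsCompact K) {ε : ℝ} (hε : 0 < ε) :
    ∃ g : α → ℝ, Continuous g ∧ (∃ C, ∀ x, |g x| ≤ C) ∧
      ∀ a ∈ K, |∫ x, u x * a x ∂μ - ∫ x, g x * a x ∂μ| < ε := by
  rcases isEmpty_or_nonempty α with hα | ⟨⟨x₀⟩⟩
  · exact ⟨0, continuous_zero, ⟨0, by simp⟩, fun a _ => by
      simpa [Measure.eq_zero_of_isEmpty μ] using hε⟩
  have hC0 : 0 ≤ C := (abs_nonneg _).trans (hC x₀)
  have hui : Integrable u μ := Integrable.of_bound hu C (ae_of_all _ hC)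
  have hpos : ∀ k : ℕ, ((k : ℝ≥0∞) + 1)⁻¹ ≠ 0 := fun k => by simp
  choose f hf hfL using fun k : ℕ =>
    (memLp_one_iff_integrable.2 hui).exists_boundedContinuous_eLpNorm_sub_le ENNReal.one_ne_top
      (hpos k)
  set g : ℕ → α → ℝ := fun k x => max (-C) (min C (f k x)) with hg
  have hgc : ∀ k, Continuous (g k) := fun k => by fun_prop
  have hgC : ∀ k x, |g k x| ≤ C := fun k x =>
    abs_le.2 ⟨le_max_left _ _, max_le (by linarith) (min_le_left _ _)⟩
  have hgm : ∀ k, AEStronglyMeasurable (g k) μ := fun k =>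
    (hgc k).measurable.aestronglyMeasurable
  have hgi : ∀ k, Integrable (g k) μ := fun k =>
    Integrable.of_bound (hgm k) C (ae_of_all _ (hgC k))
  have hL1 : Tendsto (fun k => eLpNorm (g k - u) 1 μ) atTop (𝓝 0) := by
    refine tendsto_of_tendsto_of_tendsto_of_le_of_le tendsto_const_nhds
      ENNReal.tendsto_inv_nat_nhds_zero (fun _ => zero_le) fun k => ?_
    refine le_trans ?_ ((hf k).trans (ENNReal.inv_le_inv.2 le_self_add))
    rw [eLpNorm_sub_comm]
    exact eLpNorm_mono fun x => abs_sub_clamp_le (hC x) _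
  obtain ⟨B, -, hB⟩ := exists_bound_clm_apply_eq_integral_mul μ p
  obtain ⟨S, hS, -⟩ := hB u C hu (ae_of_all _ hC)
  choose T hT hTB using fun k => hB (g k) C (hgm k) (ae_of_all _ (hgC k))
  have hlim := tendsto_of_tendsto_indicatorConstLp hp (φ := S) hTB fun c s hs hμs => by
    simp only [hT, hS, integral_mul_indicatorConstLp]
    exact (tendsto_setIntegral_of_L1' u hui.1 (Eventually.of_forall hgi) hL1 s).const_mul c
  obtain ⟨k, hk⟩ := (eventually_forall_mem_abs_sub_lt hTB hlim hK hε).exists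
  exact ⟨g k, hgc k, ⟨C, hgC k⟩, fun a ha => by simpa only [hT, hS] using hk a ha⟩

theorem hasSum_apply_indicatorConstLp [IsFiniteMeasure μ] (hp : p ≠ ∞)
    (φ : Lp ℝ p μ →L[ℝ] ℝ) {f : ℕ → Set α} (hf : ∀ i, MeasurableSet (f i))
    (hd : Pairwise (Function.onFun Disjoint f)) :
    HasSum (fun i => φ (indicatorConstLp p (hf i) (measure_ne_top μ _) 1))
      (φ (indicatorConstLp p (MeasurableSet.iUnion hf) (measure_ne_top μ _) 1)) := by
  have hfs : ∀ t : Finset ℕ, MeasurableSet (⋃ i ∈ t, f i) := fun t =>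
    t.measurableSet_biUnion fun i _ => hf i
  have hsum : ∀ t : Finset ℕ, ∑ i ∈ t, indicatorConstLp p (hf i) (measure_ne_top μ _) (1 : ℝ) =
      indicatorConstLp p (hfs t) (measure_ne_top μ _) 1 := fun t => by
    induction t using Finset.induction_on with
    | empty => simp
    | insert i t hi ih =>
      rw [Finset.sum_insert hi, ih, ← indicatorConstLp_disjoint_union]
      · simp only [Finset.set_biUnion_insert]
      · exact Set.disjoint_iUnion₂_right.2 fun j hj => hd fun h => hi (h ▸ hj)
  have hlim : Tendsto (fun t : Finset ℕ => μ (symmDiff (⋃ i ∈ t, f i) (⋃ i, f i))) atTop (𝓝 0) := by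
    have h : ∀ t : Finset ℕ, μ (symmDiff (⋃ i ∈ t, f i) (⋃ i, f i)) = ∑' i : {i // i ∉ t}, μ (f i) :=
      fun t => by
      rw [← measure_iUnion (f := fun i : {i // i ∉ t} => f i)
        (fun i j hij => hd fun h => hij (Subtype.ext h)) fun i => hf i]
      congr 1
      ext x
      simp only [Set.mem_symmDiff, Set.mem_iUnion, Subtype.exists, exists_prop]
      constructor
      · rintro (⟨⟨i, -, hx⟩, h⟩ | ⟨⟨i, hx⟩, h⟩)
        · exact (h ⟨i, hx⟩).elim
        · exact ⟨i, fun hi => h ⟨i, hi, hx⟩, hx⟩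
      · rintro ⟨i, hi, hx⟩
        refine Or.inr ⟨⟨i, hx⟩, fun ⟨j, hj, hxj⟩ => ?_⟩
        have hij : i ≠ j := fun h => hi (h ▸ hj)
        exact Set.disjoint_left.1 (hd hij) hx hxj
    simp only [h]
    refine ENNReal.tendsto_tsum_compl_atTop_zero (f := fun i => μ (f i)) ?_
    rw [← measure_iUnion hd hf]
    exact measure_ne_top μ _
  have h := (φ.continuous.tendsto _).comp (tendsto_indicatorConstLp_set (c := (1 : ℝ))
    (hs := MeasurableSet.iUnion hf) (hμs := measure_ne_top μ _) (ht := hfs)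
    (hμt := fun _ => measure_ne_top μ _) hp hlim)
  refine h.congr fun t => ?_
  rw [Function.comp_apply, ← hsum, map_sum]

/-- On indicator functions, a continuous linear functional on `L^p` is the integral against some
integrable function. -/
theorem exists_integrable_apply_indicatorConstLp_eq [IsFiniteMeasure μ] (hp : p ≠ ∞)
    (φ : Lp ℝ p μ →L[ℝ] ℝ) :
    ∃ h : α → ℝ, Measurable h ∧ Integrable h μ ∧ ∀ (c : ℝ) (s : Set α) (hs : MeasurableSet s)
      (hμs : μ s ≠ ∞), φ (indicatorConstLp p hs hμs c) = c * ∫ x in s, h x ∂μ := by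
  classical
  let m : SignedMeasure α :=
    { measureOf' := fun s =>
        if hs : MeasurableSet s then φ (indicatorConstLp p hs (measure_ne_top μ s) 1) else 0
      empty' := by simp
      not_measurable' := fun s hs => dif_neg hs
      m_iUnion' := fun f hf hd => by
        simp only [hf, MeasurableSet.iUnion hf, dif_pos]
        exact hasSum_apply_indicatorConstLp hp φ hf hd }
  have hm : ∀ (s : Set α) (hs : MeasurableSet s),
      m s = φ (indicatorConstLp p hs (measure_ne_top μ s) 1) := fun s hs => dif_pos hs
  have hac : m ≪ᵥ μ.toENNRealVectorMeasure := by
    refine VectorMeasure.AbsolutelyContinuous.mk fun s hs h0 => ?_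
    rw [Measure.toENNRealVectorMeasure_apply_measurable hs] at h0
    have : indicatorConstLp p hs (measure_ne_top μ s) (1 : ℝ) = 0 := by
      rw [← indicatorConstLp_empty, indicatorConstLp_inj _ _ _ _ one_ne_zero]
      exact ae_eq_empty.2 h0
    rw [hm s hs, this, map_zero]
  refine ⟨m.rnDeriv μ, m.measurable_rnDeriv μ, m.integrable_rnDeriv μ, fun c s hs hμs => ?_⟩
  have hc : indicatorConstLp p hs hμs c = c • indicatorConstLp p hs hμs (1 : ℝ) := by
    rw [indicatorConstLp, indicatorConstLp, ← MemLp.toLp_const_smul]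
    refine MemLp.toLp_congr _ _ (ae_of_all _ fun x => ?_)
    by_cases hx : x ∈ s <;> simp [hx]
  rw [hc, map_smul, smul_eq_mul, ← withDensityᵥ_apply (m.integrable_rnDeriv μ) hs,
    SignedMeasure.withDensityᵥ_rnDeriv_eq m μ hac, hm s hs]

/-- A continuous linear functional on `L^p` can be approximated, uniformly on compact sets, by
functionals given by bounded functions. -/
theorem exists_bounded_integral_mul_approx [IsFiniteMeasure μ] (hp : p ≠ ∞)
    (φ : Lp ℝ p μ →L[ℝ] ℝ) {K : Set (Lp ℝ p μ)} (hK : IsCompact K) {ε : ℝ} (hε : 0 < ε) :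
    ∃ u : α → ℝ, Measurable u ∧ (∃ C, ∀ x, |u x| ≤ C) ∧
      ∀ a ∈ K, |φ a - ∫ x, u x * a x ∂μ| < ε := by
  obtain ⟨h, hhm, hhi, hh⟩ := exists_integrable_apply_indicatorConstLp_eq hp φ
  set A : ℕ → Set α := fun k => {x | |h x| ≤ k} with hA
  have hAm : ∀ k, MeasurableSet (A k) := fun k =>
    measurableSet_le (continuous_abs.measurable.comp hhm) measurable_const
  have huC : ∀ (k : ℕ) x, |(A k).indicator h x| ≤ k := fun k x => by
    by_cases hx : x ∈ A k
    · rw [Set.indicator_of_mem hx]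
      exact hx
    · simp [hx]
  have hum : ∀ k, Measurable ((A k).indicator h) := fun k => hhm.indicator (hAm k)
  have hone : ∀ (k : ℕ) x, |(A k).indicator (fun _ => (1 : ℝ)) x| ≤ 1 := fun k x => by
    by_cases hx : x ∈ A k <;> simp [hx]
  choose M hM hMB using fun k => exists_clm_coeFn_ae_eq_mul (p := p) (μ := μ)
    (measurable_const.indicator (hAm k)).aestronglyMeasurable (ae_of_all _ (hone k))
  obtain ⟨B, -, hB⟩ := exists_bound_clm_apply_eq_integral_mul μ p
  choose S hS hSB using fun k : ℕ => hB _ k (hum k).aestronglyMeasurable (ae_of_all _ (huC k))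
  have hMind : ∀ k (c : ℝ) (s : Set α) (hs : MeasurableSet s) (hμs : μ s ≠ ∞),
      M k (indicatorConstLp p hs hμs c) =
        indicatorConstLp p (hs.inter (hAm k)) (measure_ne_top μ _) c := fun k c s hs hμs => by
    refine Lp.ext ?_
    filter_upwards [hM k (indicatorConstLp p hs hμs c),
      indicatorConstLp_coeFn (p := p) (hs := hs) (hμs := hμs) (c := c),
      indicatorConstLp_coeFn (p := p) (hs := hs.inter (hAm k)) (hμs := measure_ne_top μ _)
        (c := c)] with x h₁ h₂ h₃
    rw [h₁, h₂, h₃]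
    by_cases hx : x ∈ s <;> by_cases hx' : x ∈ A k <;> simp [hx, hx']
  have hSM : ∀ k a, S k a = φ (M k a) := fun k a => by
    refine Lp.induction hp (fun a => S k a = φ (M k a)) (fun c s hs hμs => ?_) ?_
      (isClosed_eq (S k).continuous (φ.continuous.comp (M k).continuous)) a
    · change S k (indicatorConstLp p hs hμs.ne c) = φ (M k (indicatorConstLp p hs hμs.ne c))
      rw [hS, hMind, hh, integral_mul_indicatorConstLp, setIntegral_indicator (hAm k)]
    · intro f g hf hg _ h₁ h₂
      simp only [map_add, h₁, h₂]
  have hbound : ∀ k a, ‖S k a‖ ≤ ‖φ‖ * ‖a‖ := fun k a => by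
    rw [hSM]
    refine (φ.le_opNorm _).trans ?_
    gcongr
    simpa using hMB k a
  have hlim := tendsto_of_tendsto_indicatorConstLp hp (φ := φ) hbound fun c s hs hμs => by
    simp only [hS, integral_mul_indicatorConstLp, hh]
    refine Tendsto.const_mul c (tendsto_integral_of_dominated_convergence (fun x => |h x|)
      (fun k => (hum k).aestronglyMeasurable) hhi.abs.integrableOn
      (fun k => ae_of_all _ fun x => ?_) (ae_of_all _ fun x => ?_))
    · by_cases hx : x ∈ A k <;> simp [hx]
    · refine tendsto_const_nhds.congr' ?_
      filter_upwards [eventually_ge_atTop ⌈|h x|⌉₊] with k hk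
      have hx : x ∈ A k := Nat.ceil_le.1 hk
      simp [hx]
  obtain ⟨k, hk⟩ := (eventually_forall_mem_abs_sub_lt hbound hlim hK hε).exists
  exact ⟨_, hum k, ⟨k, huC k⟩, fun a ha => by simpa only [hS] using hk a ha⟩

/-- A continuous linear functional on `L^p` can be approximated, uniformly on compact sets, by
functionals given by bounded continuous functions. -/
theorem exists_continuous_approx_functional [TopologicalSpace α] [NormalSpace α] [BorelSpace α]
    [IsFiniteMeasure μ] [μ.WeaklyRegular] (hp : p ≠ ∞) (φ : Lp ℝ p μ →L[ℝ] ℝ)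
    {K : Set (Lp ℝ p μ)} (hK : IsCompact K) {ε : ℝ} (hε : 0 < ε) :
    ∃ g : α → ℝ, Continuous g ∧ (∃ C, ∀ x, |g x| ≤ C) ∧
      ∀ a ∈ K, |φ a - ∫ x, g x * a x ∂μ| < ε := by
  obtain ⟨u, hu, ⟨C, hC⟩, hφu⟩ := exists_bounded_integral_mul_approx hp φ hK (half_pos hε)
  obtain ⟨g, hg, hgC, hug⟩ := exists_continuous_integral_mul_approx hp
    hu.aestronglyMeasurable hC hK (half_pos hε)
  refine ⟨g, hg, hgC, fun a ha => (abs_sub_le _ (∫ x, u x * a x ∂μ) _).trans_lt ?_⟩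
  linarith [hφu a ha, hug a ha]

end Functionals

section NeuralNetworks

variable {σ : ℝ → ℝ} {ι κ : Type*} [Fintype ι] [Fintype κ]

theorem IsNNRep.comp_equiv (e : ι ≃ κ) {n m : ℕ} {f : (ι → ℝ) → (Fin m → ℝ)}
    (hf : IsNNRep σ n m f) : IsNNRep σ n m fun w : κ → ℝ => f (w ∘ e) := by
  induction n generalizing m with
  | zero =>
    obtain ⟨W, b, rfl⟩ := hf
    refine ⟨W.submatrix id e.symm, b, funext fun w => ?_⟩
    rw [Matrix.submatrix_mulVec_equiv]
    simp
  | succ n ih =>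
    obtain ⟨k, g, W, b, hg, rfl⟩ := hf
    exact ⟨k, _, W, b, ih hg, rfl⟩

theorem IsNN.comp_equiv (e : ι ≃ κ) {n : ℕ} {f : (ι → ℝ) → ℝ} (hf : IsNN σ n f) :
    IsNN σ n fun w : κ → ℝ => f (w ∘ e) := by
  obtain ⟨g, hg, rfl⟩ := hf
  exact ⟨_, hg.comp_equiv e, rfl⟩

theorem IsNNRep.continuous (hσ : Continuous σ) {n m : ℕ} {f : (ι → ℝ) → (Fin m → ℝ)}
    (hf : IsNNRep σ n m f) : Continuous f := by
  induction n generalizing m with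
  | zero =>
    obtain ⟨W, b, rfl⟩ := hf
    fun_prop
  | succ n ih =>
    obtain ⟨k, g, W, b, hg, rfl⟩ := hf
    have := ih hg
    fun_prop

theorem IsNN.continuous (hσ : Continuous σ) {n : ℕ} {f : (ι → ℝ) → ℝ} (hf : IsNN σ n f) :
    Continuous f := by
  obtain ⟨g, hg, rfl⟩ := hf
  exact (continuous_apply 0).comp (hg.continuous hσ)

/-- For fixed `L`, the networks of depth `L` on `ℝ^d × ℝ^d` approximate, uniformly on compact sets,
continuous functions of the second variable. -/
theorem MemA0.exists_isNN_approx_snd (hσ : MemA0 σ) (d : ℕ) : ∃ L : ℕ,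
    ∀ s t : Set (Fin d → ℝ), IsCompact s → IsCompact t →
      ∀ g : (Fin d → ℝ) → ℝ, Continuous g → ∀ ε : ℝ, 0 < ε →
        ∃ q : (Fin d ⊕ Fin d → ℝ) → ℝ, IsNN σ L q ∧
          ∀ y ∈ s, ∀ x ∈ t, |g x - q (Sum.elim y x)| ≤ ε := by
  obtain ⟨-, L, hL⟩ := hσ
  refine ⟨L, fun s t hs ht g hg ε hε => ?_⟩
  let e : Fin (d + d) ≃ Fin d ⊕ Fin d := finSumFinEquiv.symm
  have hcont : Continuous fun z : (Fin d → ℝ) × (Fin d → ℝ) => Sum.elim z.1 z.2 ∘ e := by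
    refine continuous_pi fun i => ?_
    rcases h : e i with j | j <;> simp only [Function.comp_apply, h, Sum.elim_inl, Sum.elim_inr] <;>
      fun_prop
  obtain ⟨r, hr, hrg⟩ := hL (d + d) _ ((hs.prod ht).image hcont)
    (fun z => g fun j => z (e.symm (Sum.inr j))) (Continuous.continuousOn (by fun_prop)) ε hε
  refine ⟨_, hr.comp_equiv e, fun y hy x hx => ?_⟩
  simpa using hrg _ ⟨(y, x), ⟨hy, hx⟩, rfl⟩

end NeuralNetworks

/-- Finitely many continuous linear functionals on `L^p(D; ℝ)` can be simultaneously
approximated, uniformly over a compact set and over `y ∈ cl D`, by a neural-network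
kernel integral operator (Lemma D.1 for the `L^p` case). -/
theorem functionals_approx_by_nn_kernel_Lp
    (d n : ℕ) (D : Set (Fin d → ℝ)) (hD : IsRegularDomain D)
    (p : ℝ≥0∞) [Fact (1 ≤ p)] (hp : p ≠ ∞)
    (c : Fin n → (Lp ℝ p ((volume : Measure (Fin d → ℝ)).restrict D) →L[ℝ] ℝ))
    (K : Set (Lp ℝ p ((volume : Measure (Fin d → ℝ)).restrict D))) (hK : IsCompact K)
    (σ : ℝ → ℝ) (hσ : MemA0 σ) (ε : ℝ) (hε : 0 < ε) :
    ∃ (L : ℕ) (κ : ((Fin d ⊕ Fin d) → ℝ) → Matrix (Fin n) (Fin 1) ℝ),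
      IsNNM σ L κ ∧
      ∀ a ∈ K, ∀ y ∈ closure D,
        ∑ i : Fin n,
          |c i a - ∫ x in D, κ (Sum.elim y x) i 0 * a x| ≤ ε := by
  obtain ⟨hDo, -, hDb, -⟩ := hD
  have hDc : IsCompact (closure D) := hDb.isCompact_closure
  have : IsFiniteMeasure ((volume : Measure (Fin d → ℝ)).restrict D) :=
    isFiniteMeasure_restrict.2 hDb.measure_lt_top.ne
  obtain ⟨R, hR0, hR⟩ := hK.isBounded.exists_pos_norm_le
  obtain ⟨B, hB0, hB⟩ :=
    exists_bound_clm_apply_eq_integral_mul ((volume : Measure (Fin d → ℝ)).restrict D) p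
  obtain ⟨L, hL⟩ := hσ.exists_isNN_approx_snd d
  set η : ℝ := ε / (2 * (n + 1)) with hη
  have hη0 : 0 < η := by positivity
  set δ : ℝ := η / (B * R + 1) with hδ
  have hδ0 : 0 < δ := by positivity
  have hδη : B * δ * R ≤ η := by
    rw [hδ, mul_div_assoc', div_mul_eq_mul_div, div_le_iff₀ (by positivity)]
    nlinarith
  choose g hgc hgb hg using fun i => exists_continuous_approx_functional hp (c i) hK hη0
  choose q hq hqg using fun i => hL _ _ hDc hDc (g i) (hgc i) δ hδ0
  refine ⟨L, fun w => Matrix.of fun i _ => q i w, fun i _ => hq i, fun a ha y hy => ?_⟩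
  have hterm : ∀ i, |c i a - ∫ x in D, q i (Sum.elim y x) * a x| ≤ 2 * η := fun i => by
    obtain ⟨C, hC⟩ := hgb i
    have hqm : AEStronglyMeasurable (fun x => q i (Sum.elim y x)) (volume.restrict D) := by
      refine Continuous.aestronglyMeasurable (((hq i).continuous hσ.1).comp ?_)
      refine continuous_pi fun j => ?_
      rcases j with j | j <;> simp only [Sum.elim_inl, Sum.elim_inr] <;> fun_prop
    have hgm : AEStronglyMeasurable (g i) (volume.restrict D) := (hgc i).aestronglyMeasurable
    have hdiff : ∀ᵐ x ∂volume.restrict D, |g i x - q i (Sum.elim y x)| ≤ δ := by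
      filter_upwards [ae_restrict_mem hDo.measurableSet] with x hx
      exact hqg i y hy x (subset_closure hx)
    have hqb : ∀ᵐ x ∂volume.restrict D, |q i (Sum.elim y x)| ≤ C + δ := by
      filter_upwards [hdiff] with x hx
      have h₁ := hC x
      rw [abs_le] at h₁ hx ⊢
      constructor <;> linarith
    obtain ⟨T, hT, hTB⟩ := hB _ δ (hgm.sub hqm) hdiff
    have hsub : (∫ x in D, g i x * a x) - ∫ x in D, q i (Sum.elim y x) * a x = T a := by
      rw [hT, ← integral_sub (Lp.integrable_mul_of_ae_bdd hgm (ae_of_all _ hC) a)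
        (Lp.integrable_mul_of_ae_bdd hqm hqb a)]
      simp only [Pi.sub_apply, sub_mul]
    have hTa : |T a| ≤ η := by
      refine (hTB a).trans (le_trans ?_ hδη)
      gcongr
      exact hR a ha
    rw [← hsub] at hTa
    linarith [abs_sub_le (c i a) (∫ x in D, g i x * a x) (∫ x in D, q i (Sum.elim y x) * a x),
      hg i a ha]
  calc ∑ i : Fin n, |c i a - ∫ x in D, q i (Sum.elim y x) * a x|
      ≤ ∑ _i : Fin n, 2 * η := Finset.sum_le_sum fun i _ => hterm i
    _ = n * (2 * η) := by simp
    _ ≤ ε := by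
      rw [hη]
      field_simp
      linarith

end
end
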